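/- arXiv:0708.3191 — 2 statements merged into one kernel-verified Lean document; each statement's English description precedes it below -/
import Mathlib

section
/- Let V be a complex vector space of dimension N, let Q be a quadratic form on V of rank n. Then every nonzero finite-dimensional indecomposable projective module over the Clifford algebra Cl(Q) has dimension 2^{N − ⌈n/2⌉} over ℂ. -/
section IndecomposableProjective

variable {A M ι : Type*} [Ring A] [Algebra ℂ A] [AddCommGroup M] [Module ℂ M] [Module A M]
  [IsScalarTower ℂ A M] [FiniteDimensional ℂ M] [Fintype ι]

theorem exists_not_isNilpotent_of_sum_eq_one [Nontrivial M] [Module.Projective A M] (p : ι → A)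
    (hsum : ∑ i, p i = 1) :
    ∃ (i : ι) (φ : M →ₗ[A] A) (x : M), ¬ IsNilpotent (R := Module.End A M)
      (LinearMap.toSpanSingleton A M x ∘ₗ LinearMap.toSpanSingleton A A (p i) ∘ₗ φ) := by
  have : Module.Finite A M := .of_restrictScalars_finite ℂ A M
  obtain ⟨n, f, g, -, -, hfg⟩ := Module.Finite.exists_comp_eq_id_of_projective A M
  by_contra! hnil
  let ψ (k : Fin n) (i : ι) : Module.End A M :=
    LinearMap.toSpanSingleton A M (f (Pi.single k 1)) ∘ₗ
      LinearMap.toSpanSingleton A A (p i) ∘ₗ LinearMap.proj k ∘ₗ g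
  have hid : ∑ k, ∑ i, (ψ k i).restrictScalars ℂ = LinearMap.id := by
    ext m
    have hm : f (g m) = m := LinearMap.congr_fun hfg m
    simp only [LinearMap.sum_apply, LinearMap.restrictScalars_apply, LinearMap.id_apply, ψ,
      LinearMap.comp_apply, LinearMap.toSpanSingleton_apply, LinearMap.proj_apply, smul_eq_mul,
      ← Finset.sum_smul, ← Finset.mul_sum, hsum, mul_one]
    conv_rhs => rw [← hm, pi_eq_sum_univ' (g m), map_sum]
    refine Finset.sum_congr rfl fun k _ => ?_
    rw [← map_smul]
  have htr : ∀ k i, LinearMap.trace ℂ M ((ψ k i).restrictScalars ℂ) = 0 := by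
    intro k i
    refine (LinearMap.isNilpotent_trace_of_isNilpotent ?_).eq_zero
    obtain ⟨r, hr⟩ := hnil i (LinearMap.proj k ∘ₗ g) (f (Pi.single k 1))
    refine ⟨r, ?_⟩
    ext m
    have := LinearMap.congr_fun hr m
    rw [Module.End.pow_apply] at this ⊢
    exact this
  have := congr_arg (LinearMap.trace ℂ M) hid
  simp only [map_sum, htr, Finset.sum_const_zero, LinearMap.trace_id] at this
  exact Module.finrank_pos (R := ℂ) (M := M) |>.ne (by exact_mod_cast this)

theorem injective_of_not_isNilpotent
    (hindec : ¬ ∃ N₁ N₂ : Submodule A M, N₁ ≠ ⊥ ∧ N₂ ≠ ⊥ ∧ IsCompl N₁ N₂)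
    (f : Module.End A M) (hf : ¬ IsNilpotent f) : Function.Injective f := by
  have : IsNoetherian A M := isNoetherian_of_tower ℂ inferInstance
  have : IsArtinian A M := isArtinian_of_tower ℂ inferInstance
  obtain ⟨n, hn, hn0⟩ := (f.eventually_isCompl_ker_pow_range_pow.and
    (Filter.eventually_ge_atTop 1)).exists
  by_cases hr : LinearMap.range (f ^ n) = ⊥
  · exact absurd ⟨n, LinearMap.range_eq_bot.mp hr⟩ hf
  · have hk : LinearMap.ker (f ^ n) = ⊥ := by
      by_contra hk
      exact hindec ⟨_, _, hk, hr, hn⟩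
    rw [LinearMap.ker_eq_bot, Module.End.coe_pow] at hk
    obtain ⟨m, rfl⟩ := Nat.exists_eq_add_of_le' hn0
    rw [Function.iterate_succ] at hk
    exact hk.of_comp

/-- An indecomposable projective module which is finite-dimensional is isomorphic to `A p` for one
of the members `p` of any finite family of primitive idempotents with sum `1`; only the equality
of dimensions is recorded. -/
theorem exists_finrank_eq_finrank_range_mulRight [Nontrivial M] [Module.Projective A M]
    (hindec : ¬ ∃ N₁ N₂ : Submodule A M, N₁ ≠ ⊥ ∧ N₂ ≠ ⊥ ∧ IsCompl N₁ N₂)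
    (p : ι → A) (hp : ∀ i, p i * p i = p i) (hsum : ∑ i, p i = 1)
    (hprim : ∀ i q, q * q = q → p i * q = q → q * p i = q → q = 0 ∨ q = p i) :
    ∃ i, Module.finrank ℂ M = Module.finrank ℂ (LinearMap.range (LinearMap.mulRight ℂ (p i))) := by
  obtain ⟨i, φ, x, hnil⟩ := exists_not_isNilpotent_of_sum_eq_one (M := M) p hsum
  refine ⟨i, ?_⟩
  set α : M →ₗ[A] A := LinearMap.toSpanSingleton A A (p i) ∘ₗ φ
  set ψ : Module.End A M := LinearMap.toSpanSingleton A M x ∘ₗ α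
  have hα m : α m = φ m * p i := rfl
  have hψ m : ψ m = α m • x := rfl
  have hαp m : α m * p i = α m := by rw [hα, mul_assoc, hp]
  have hinj := injective_of_not_isNilpotent hindec ψ hnil
  have hαinj : Function.Injective α := fun a b h => hinj (by rw [hψ, hψ, h])
  obtain ⟨y, hy⟩ : ∃ y, ψ y = x := (LinearMap.injective_iff_surjective
    (f := ψ.restrictScalars ℂ)).mp hinj x
  have hq m : α m * α y = α m := by
    rw [← smul_eq_mul, ← map_smul]
    congr 1
    apply hinj
    rw [map_smul, hy, hψ]
  have hqq m : α m * (p i * α y) = α m := by rw [← mul_assoc, hαp, hq]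
  have hpy : p i * α y = p i := by
    refine (hprim i _ ?_ ?_ ?_).resolve_left fun h0 => ?_
    · rw [mul_assoc, hqq]
    · rw [← mul_assoc, hp]
    · rw [mul_assoc, hαp]
    · obtain ⟨m, hm⟩ := exists_ne (0 : M)
      refine hm (hαinj ?_)
      rw [map_zero, ← hqq, h0, mul_zero]
  suffices LinearMap.range (α.restrictScalars ℂ) = LinearMap.range (LinearMap.mulRight ℂ (p i)) by
    rw [← this, LinearMap.finrank_range_of_inj (f := α.restrictScalars ℂ) hαinj]
  ext a
  constructor
  · rintro ⟨m, rfl⟩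
    exact ⟨φ m, rfl⟩
  · rintro ⟨a, rfl⟩
    refine ⟨a • p i • y, ?_⟩
    simp [hpy]

end IndecomposableProjective

section Idempotents

variable {A κ : Type*} [Ring A] [Algebra ℂ A] [Fintype κ]

theorem exists_idempotents_of_involutions_comm {C : Type*} [CommRing C] [Algebra ℂ C]
    [DecidableEq κ]
    (h : κ → C) (hsq : ∀ j, h j * h j = 1) :
    ∃ p : (κ → ℤˣ) → C, ∑ s, p s = 1 ∧ (∀ s, p s * p s = p s) ∧
      ∀ s j, h j * p s = ((s j : ℤ) : ℂ) • p s := by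
  let e (j : κ) (u : ℤˣ) : C := (1 / 2 : ℂ) • (1 + ((u : ℤ) : ℂ) • h j)
  have he_sum j : ∑ u, e j u = 1 := by
    simp only [e, UnitsInt.univ]
    rw [Finset.sum_pair (by decide)]
    simp only [Units.val_one, Units.val_neg, Int.cast_one, Int.cast_neg]
    module
  have he_mul j u : h j * e j u = ((u : ℤ) : ℂ) • e j u := by
    simp only [e, mul_smul_comm, mul_add, mul_one, hsq]
    rcases Int.units_eq_one_or u with rfl | rfl <;>
    · simp only [Units.val_one, Units.val_neg, Int.cast_one, Int.cast_neg]
      module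
  have he_idem j u : e j u * e j u = e j u := by
    conv_lhs => enter [1]; simp only [e]
    simp only [smul_mul_assoc, add_mul, one_mul, he_mul]
    rcases Int.units_eq_one_or u with rfl | rfl <;>
    · simp only [Units.val_one, Units.val_neg, Int.cast_one, Int.cast_neg]
      module
  refine ⟨fun s => ∏ j, e j (s j), ?_, fun s => ?_, fun s j => ?_⟩
  · have := Finset.prod_univ_sum (fun _ : κ => (Finset.univ : Finset ℤˣ)) e
    simpa only [he_sum, Finset.prod_const_one, Fintype.piFinset_univ] using this.symm
  · simp [← Finset.prod_mul_distrib, he_idem]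
  · simp only
    rw [← Finset.mul_prod_erase _ _ (Finset.mem_univ j), ← mul_assoc, he_mul, smul_mul_assoc]

open scoped IsMulCommutative in
/-- Simultaneous eigenprojections of a finite family of commuting involutions. -/
theorem exists_idempotents_of_involutions [DecidableEq κ] (h : κ → A)
    (hcomm : ∀ i j, h i * h j = h j * h i) (hsq : ∀ j, h j * h j = 1) :
    ∃ p : (κ → ℤˣ) → A, ∑ s, p s = 1 ∧ (∀ s, p s * p s = p s) ∧
      (∀ s j, h j * p s = ((s j : ℤ) : ℂ) • p s) ∧ ∀ s j, p s * h j = ((s j : ℤ) : ℂ) • p s := by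
  have : IsMulCommutative (Algebra.adjoin ℂ (Set.range h)) :=
    Algebra.isMulCommutative_adjoin ℂ (by rintro _ ⟨i, rfl⟩ _ ⟨j, rfl⟩; exact hcomm i j)
  let C := Algebra.adjoin ℂ (Set.range h)
  obtain ⟨p, hsum, hp, hhp⟩ := exists_idempotents_of_involutions_comm
    (fun j => (⟨h j, Algebra.subset_adjoin ⟨j, rfl⟩⟩ : C)) (fun j => Subtype.ext (hsq j))
  refine ⟨fun s => p s, ?_, fun s => congr_arg Subtype.val (hp s),
    fun s j => congr_arg Subtype.val (hhp s j), fun s j => ?_⟩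
  · simpa using congr_arg Subtype.val hsum
  · have := hhp s j
    rw [mul_comm] at this
    exact congr_arg Subtype.val this

end Idempotents

section Anticommuting

variable {A : Type*} [Ring A] [Algebra ℂ A]

theorem exists_mul_eq_mul_of_anticommute {S : Set A} {v : A} (hv : ∀ g ∈ S, v * g = -(g * v))
    {s : A} (hs : s ∈ Algebra.adjoin ℂ S) : ∃ t ∈ Algebra.adjoin ℂ S, v * s = t * v := by
  induction hs using Algebra.adjoin_induction with
  | mem g hg => exact ⟨-g, neg_mem (Algebra.subset_adjoin hg), by rw [hv g hg, neg_mul]⟩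
  | algebraMap r => exact ⟨_, algebraMap_mem _ r, (Algebra.commutes r v).symm⟩
  | add a b _ _ ha hb =>
    obtain ⟨a', ha', h₁⟩ := ha
    obtain ⟨b', hb', h₂⟩ := hb
    exact ⟨a' + b', add_mem ha' hb', by rw [mul_add, h₁, h₂, add_mul]⟩
  | mul a b _ _ ha hb =>
    obtain ⟨a', ha', h₁⟩ := ha
    obtain ⟨b', hb', h₂⟩ := hb
    exact ⟨a' * b', mul_mem ha' hb', by rw [← mul_assoc, h₁, mul_assoc, h₂, mul_assoc]⟩

theorem exists_eq_add_mul_of_mem_adjoin_insert {S : Set A} {v : A} {c : ℂ}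
    (hv : ∀ g ∈ S, v * g = -(g * v)) (hvv : v * v = algebraMap ℂ A c) {s : A}
    (hs : s ∈ Algebra.adjoin ℂ (insert v S)) :
    ∃ a ∈ Algebra.adjoin ℂ S, ∃ b ∈ Algebra.adjoin ℂ S, s = a + v * b := by
  suffices ∀ a ∈ Algebra.adjoin ℂ S, ∀ b ∈ Algebra.adjoin ℂ S,
      ∃ a' ∈ Algebra.adjoin ℂ S, ∃ b' ∈ Algebra.adjoin ℂ S, s * (a + v * b) = a' + v * b' by
    simpa using this 1 (one_mem _) 0 (zero_mem _)
  induction hs using Algebra.adjoin_induction with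
  | mem g hg =>
    intro a ha b hb
    rcases hg with rfl | hg
    · exact ⟨algebraMap ℂ A c * b, mul_mem (algebraMap_mem _ c) hb, a, ha, by
        rw [mul_add, ← mul_assoc, hvv, add_comm]⟩
    · have hg' := Algebra.subset_adjoin (R := ℂ) hg
      refine ⟨g * a, mul_mem hg' ha, -(g * b), neg_mem (mul_mem hg' hb), ?_⟩
      rw [mul_add, mul_neg, ← mul_assoc, ← mul_assoc, hv g hg, neg_mul, neg_neg]
  | algebraMap r =>
    intro a ha b hb
    refine ⟨algebraMap ℂ A r * a, mul_mem (algebraMap_mem _ r) ha, algebraMap ℂ A r * b,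
      mul_mem (algebraMap_mem _ r) hb, ?_⟩
    rw [mul_add, Algebra.left_comm]
  | add x y _ _ hx hy =>
    intro a ha b hb
    obtain ⟨a₁, ha₁, b₁, hb₁, h₁⟩ := hx a ha b hb
    obtain ⟨a₂, ha₂, b₂, hb₂, h₂⟩ := hy a ha b hb
    refine ⟨a₁ + a₂, add_mem ha₁ ha₂, b₁ + b₂, add_mem hb₁ hb₂, ?_⟩
    rw [add_mul, h₁, h₂, mul_add]
    abel
  | mul x y _ _ hx hy =>
    intro a ha b hb
    obtain ⟨a₁, ha₁, b₁, hb₁, h₁⟩ := hy a ha b hb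
    obtain ⟨a₂, ha₂, b₂, hb₂, h₂⟩ := hx a₁ ha₁ b₁ hb₁
    exact ⟨a₂, ha₂, b₂, hb₂, by rw [mul_assoc, h₁, h₂]⟩

theorem mem_jacobson_of_anticommute {S : Set A} (hS : Algebra.adjoin ℂ S = ⊤) {v : A}
    (hv : ∀ g ∈ S, v * g = -(g * v)) (hvv : v * v = 0) : v ∈ Ring.jacobson A := by
  rw [← Ideal.jacobson_bot, Ideal.mem_jacobson_iff]
  intro y
  obtain ⟨t, -, ht⟩ := exists_mul_eq_mul_of_anticommute hv (s := y) (hS ▸ Algebra.mem_top)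
  refine ⟨1 - y * v, ?_⟩
  have : y * v * (y * v) = 0 := by
    rw [mul_assoc, ← mul_assoc v, ht, mul_assoc t, hvv, mul_zero, mul_zero]
  rw [Ideal.mem_bot, mul_assoc, sub_mul, this]
  noncomm_ring

omit [Algebra ℂ A] in
theorem eq_zero_of_mul_self_eq_of_mem_jacobson {q : A} (hq : q * q = q)
    (hJ : q ∈ Ring.jacobson A) : q = 0 := by
  rw [← Ideal.jacobson_bot, Ideal.mem_jacobson_iff] at hJ
  obtain ⟨z, hz⟩ := hJ (-1)
  rw [Ideal.mem_bot, sub_eq_zero] at hz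
  calc q = (z * -1 * q + z) * q := by rw [hz, one_mul]
    _ = 0 := by rw [add_mul, mul_assoc, hq]; noncomm_ring

theorem eq_zero_or_eq_of_sub_smul_mem_jacobson {p q : A} {c : ℂ} (hp : p * p = p) (hq : q * q = q)
    (hpq : p * q = q) (hqp : q * p = q) (hJ : q - c • p ∈ Ring.jacobson A) : q = 0 ∨ q = p := by
  have hsmul (d : ℂ) {a : A} (ha : a ∈ Ring.jacobson A) : d • a ∈ Ring.jacobson A := by
    rw [Algebra.smul_def]
    exact Ideal.mul_mem_left _ _ ha
  by_cases hc : c = 0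
  · left
    exact eq_zero_of_mul_self_eq_of_mem_jacobson hq (by simpa [hc] using hJ)
  · right
    have h1 : (p - q) * (q - c • p) = (-c) • (p - q) := by
      simp only [sub_mul, mul_sub, mul_smul_comm, hp, hq, hpq, hqp]
      module
    have h2 := hsmul (-c)⁻¹ (h1 ▸ Ideal.mul_mem_left _ (p - q) hJ)
    rw [smul_smul, inv_mul_cancel₀ (neg_ne_zero.mpr hc), one_smul] at h2
    refine (sub_eq_zero.mp (eq_zero_of_mul_self_eq_of_mem_jacobson ?_ h2)).symm
    simp only [sub_mul, mul_sub, hp, hq, hpq, hqp]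
    abel

end Anticommuting

section CliffordSystem

variable {A μ τ δ : Type*} [Ring A] [Algebra ℂ A]

/-- Pairwise anticommuting generators of an algebra: two square roots of `1` for each element of
`μ`, one for each element of `τ`, and a square root of `0` for each element of `δ`. -/
structure IsCliffordSystem (x : (μ × Bool) ⊕ τ ⊕ δ → A) : Prop where
  anticomm : ∀ i j, i ≠ j → x i * x j = -(x j * x i)
  sq_pair : ∀ j, x (.inl j) * x (.inl j) = 1
  sq_single : ∀ t, x (.inr (.inl t)) * x (.inr (.inl t)) = 1
  sq_radical : ∀ k, x (.inr (.inr k)) * x (.inr (.inr k)) = 0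
  adjoin_range : Algebra.adjoin ℂ (Set.range x) = ⊤

/-- The involutions `i x y`, for the pairs `x, y`, and `x`, for the single generators `x`. -/
noncomputable def cliffordInvolution (x : (μ × Bool) ⊕ τ ⊕ δ → A) : μ ⊕ τ → A :=
  Sum.elim (fun j => Complex.I • (x (.inl (j, false)) * x (.inl (j, true))))
    (fun t => x (.inr (.inl t)))

/-- The first members of the pairs in `T`, and all generators of square zero. -/
def polarizingSet (x : (μ × Bool) ⊕ τ ⊕ δ → A) (T : Set μ) : Set A :=
  (fun j => x (.inl (j, false))) '' T ∪ Set.range fun k => x (.inr (.inr k))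

namespace IsCliffordSystem

variable {x : (μ × Bool) ⊕ τ ⊕ δ → A} (hx : IsCliffordSystem x)
include hx

theorem commute_cliffordInvolution_inl {j : μ} {i : (μ × Bool) ⊕ τ ⊕ δ}
    (hi : ∀ b, i ≠ .inl (j, b)) : Commute (cliffordInvolution x (.inl j)) (x i) := by
  refine Commute.smul_left ?_ _
  rw [commute_iff_eq, mul_assoc, hx.anticomm _ i (hi true).symm, mul_neg, ← mul_assoc,
    hx.anticomm _ i (hi false).symm, neg_mul, neg_neg, mul_assoc]

theorem cliffordInvolution_inl_mul (j : μ) :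
    cliffordInvolution x (.inl j) * x (.inl (j, false)) =
      -(x (.inl (j, false)) * cliffordInvolution x (.inl j)) := by
  simp only [cliffordInvolution, Sum.elim_inl, smul_mul_assoc, mul_smul_comm]
  rw [mul_assoc, hx.anticomm (.inl (j, true)) (.inl (j, false)) (by simp), mul_neg, smul_neg]

theorem pair_true_eq (j : μ) : x (.inl (j, true)) =
    (-Complex.I) • (x (.inl (j, false)) * cliffordInvolution x (.inl j)) := by
  simp only [cliffordInvolution, Sum.elim_inl, mul_smul_comm]
  rw [← mul_assoc, hx.sq_pair, one_mul, smul_smul]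
  simp

theorem cliffordInvolution_sq (j : μ ⊕ τ) :
    cliffordInvolution x j * cliffordInvolution x j = 1 := by
  rcases j with j | t
  · conv_lhs => enter [2]; simp only [cliffordInvolution, Sum.elim_inl]
    rw [mul_smul_comm, ← mul_assoc, hx.cliffordInvolution_inl_mul, neg_mul, mul_assoc]
    conv_lhs => simp only [cliffordInvolution, Sum.elim_inl]
    rw [smul_mul_assoc, mul_smul_comm, mul_assoc (x _) (x _) (x (.inl (j, true))), hx.sq_pair,
      mul_one, hx.sq_pair]
    rw [smul_neg, smul_smul]
    simp
  · exact hx.sq_single t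

theorem cliffordInvolution_comm [Subsingleton τ] (i j : μ ⊕ τ) :
    cliffordInvolution x i * cliffordInvolution x j =
      cliffordInvolution x j * cliffordInvolution x i := by
  have aux (i : μ) (j : μ ⊕ τ) (hij : .inl i ≠ j) :
      Commute (cliffordInvolution x (.inl i)) (cliffordInvolution x j) := by
    rcases j with j | t
    · have hij' : j ≠ i := by rintro rfl; exact hij rfl
      refine Commute.smul_right (Commute.mul_right ?_ ?_) _ <;>
        exact hx.commute_cliffordInvolution_inl (by simp [hij'])
    · exact hx.commute_cliffordInvolution_inl (by simp)
  by_cases hij : i = j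
  · rw [hij]
  · rcases i with i | i
    · exact aux i j hij
    · rcases j with j | j
      · exact (aux j _ (by simp)).symm
      · exact absurd (congr_arg Sum.inr (Subsingleton.elim i j)) hij

theorem anticomm_polarizingSet {T : Set μ} {i : (μ × Bool) ⊕ τ ⊕ δ}
    (hi : ∀ j ∈ T, i ≠ .inl (j, false)) (hi' : ∀ k, i ≠ .inr (.inr k)) :
    ∀ g ∈ polarizingSet x T, x i * g = -(g * x i) := by
  rintro _ (⟨j, hj, rfl⟩ | ⟨k, rfl⟩)
  · exact hx.anticomm _ _ (hi j hj)
  · exact hx.anticomm _ _ (hi' k)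

theorem radical_mem_jacobson (k : δ) : x (.inr (.inr k)) ∈ Ring.jacobson A := by
  refine mem_jacobson_of_anticommute hx.adjoin_range ?_ (hx.sq_radical k)
  rintro _ ⟨i, rfl⟩
  by_cases hi : .inr (.inr k) = i
  · rw [← hi, hx.sq_radical, neg_zero]
  · exact hx.anticomm _ _ hi

/-- `A p = S p`, for `S` the subalgebra generated by the polarizing set. -/
theorem exists_mul_eq_mul {p : A} {ε : μ ⊕ τ → ℂ}
    (hp : ∀ j, cliffordInvolution x j * p = ε j • p) (a : A) :
    ∃ s ∈ Algebra.adjoin ℂ (polarizingSet x Set.univ), a * p = s * p := by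
  suffices ∀ s ∈ Algebra.adjoin ℂ (polarizingSet x Set.univ),
      ∃ t ∈ Algebra.adjoin ℂ (polarizingSet x Set.univ), a * (s * p) = t * p by
    simpa using this 1 (one_mem _)
  have ha : a ∈ Algebra.adjoin ℂ (Set.range x) := hx.adjoin_range ▸ Algebra.mem_top
  induction ha using Algebra.adjoin_induction with
  | mem g hg =>
    intro s hs
    by_cases hgS : g ∈ polarizingSet x Set.univ
    · exact ⟨g * s, mul_mem (Algebra.subset_adjoin hgS) hs, (mul_assoc _ _ _).symm⟩
    obtain ⟨i, rfl⟩ := hg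
    have hi : ∀ j ∈ Set.univ, i ≠ .inl (j, false) := by
      rintro j hj rfl
      exact hgS (.inl ⟨j, hj, rfl⟩)
    have hi' : ∀ k, i ≠ .inr (.inr k) := by
      rintro k rfl
      exact hgS (.inr ⟨k, rfl⟩)
    obtain ⟨s', hs', h⟩ := exists_mul_eq_mul_of_anticommute (hx.anticomm_polarizingSet hi hi') hs
    obtain ⟨t, ht, htp⟩ : ∃ t ∈ Algebra.adjoin ℂ (polarizingSet x Set.univ), x i * p = t * p := by
      rcases i with ⟨j, _ | _⟩ | i | k
      · exact absurd rfl (hi j trivial)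
      · refine ⟨(-Complex.I * ε (.inl j)) • x (.inl (j, false)), Subalgebra.smul_mem _
          (Algebra.subset_adjoin (.inl ⟨j, trivial, rfl⟩)) _, ?_⟩
        rw [hx.pair_true_eq, smul_mul_assoc, mul_assoc, hp, mul_smul_comm, smul_smul,
          smul_mul_assoc]
      · exact ⟨algebraMap ℂ A (ε (.inr i)), algebraMap_mem _ _, by
          rw [← Algebra.smul_def, ← hp]; rfl⟩
      · exact absurd rfl (hi' k)
    exact ⟨s' * t, mul_mem hs' ht, by rw [← mul_assoc, h, mul_assoc, htp, mul_assoc]⟩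
  | algebraMap r =>
    intro s hs
    exact ⟨_, mul_mem (algebraMap_mem _ r) hs, (mul_assoc _ _ _).symm⟩
  | add a b _ _ ha hb =>
    intro s hs
    obtain ⟨a', ha', h₁⟩ := ha s hs
    obtain ⟨b', hb', h₂⟩ := hb s hs
    exact ⟨a' + b', add_mem ha' hb', by rw [add_mul, h₁, h₂, add_mul]⟩
  | mul a b _ _ ha hb =>
    intro s hs
    obtain ⟨b', hb', h₂⟩ := hb s hs
    obtain ⟨a', ha', h₁⟩ := ha b' hb'
    exact ⟨a', ha', by rw [mul_assoc, h₂, h₁]⟩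

theorem exists_sub_smul_mem_jacobson {p : A} {ε : μ ⊕ τ → ℂ} (hpp : p * p = p)
    (hε : ∀ j, ε j ≠ 0) (hp : ∀ j, cliffordInvolution x j * p = ε j • p)
    (hp' : ∀ j, p * cliffordInvolution x j = ε j • p) (T : Finset μ) {s : A}
    (hs : s ∈ Algebra.adjoin ℂ (polarizingSet x T)) :
    ∃ c : ℂ, p * s * p - c • p ∈ Ring.jacobson A := by
  classical
  induction T using Finset.induction_on generalizing s with
  | empty =>
    suffices ∃ c : ℂ, s - algebraMap ℂ A c ∈ Ring.jacobson A by
      obtain ⟨c, hc⟩ := this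
      refine ⟨c, ?_⟩
      have := Ideal.mul_mem_right p _ (Ideal.mul_mem_left _ p hc)
      rwa [mul_sub, sub_mul, ← Algebra.commutes, ← Algebra.smul_def, smul_mul_assoc, hpp] at this
    induction hs using Algebra.adjoin_induction with
    | mem g hg =>
      rcases hg with ⟨j, hj, -⟩ | ⟨k, rfl⟩
      · simp at hj
      · exact ⟨0, by simpa using hx.radical_mem_jacobson k⟩
    | algebraMap r => exact ⟨r, by simp⟩
    | add a b _ _ ha hb =>
      obtain ⟨c, hc⟩ := ha
      obtain ⟨d, hd⟩ := hb
      refine ⟨c + d, ?_⟩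
      rw [map_add, add_sub_add_comm]
      exact add_mem hc hd
    | mul a b _ _ ha hb =>
      obtain ⟨c, hc⟩ := ha
      obtain ⟨d, hd⟩ := hb
      refine ⟨c * d, ?_⟩
      have : a * b - algebraMap ℂ A (c * d) =
          (a - algebraMap ℂ A c) * b + algebraMap ℂ A c * (b - algebraMap ℂ A d) := by
        rw [map_mul]
        noncomm_ring
      rw [this]
      exact add_mem (Ideal.mul_mem_right _ _ hc) (Ideal.mul_mem_left _ _ hd)
  | insert j T hj ih =>
    have hset : polarizingSet x (insert j T : Finset μ) =
        insert (x (.inl (j, false))) (polarizingSet x T) := by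
      rw [polarizingSet, Finset.coe_insert, Set.image_insert_eq, Set.insert_union, polarizingSet]
    rw [hset] at hs
    obtain ⟨a, ha, b, hb, rfl⟩ := exists_eq_add_mul_of_mem_adjoin_insert
      (hx.anticomm_polarizingSet (T := T) (i := .inl (j, false))
        (by rintro i hi h; simp_all) (by simp))
      (c := 1) (by rw [hx.sq_pair, map_one]) hs
    have hb' : Commute (cliffordInvolution x (.inl j)) b := by
      refine Algebra.commute_of_mem_adjoin_of_forall_mem_commute hb ?_
      rintro _ (⟨i, hi, rfl⟩ | ⟨k, rfl⟩)
      · refine hx.commute_cliffordInvolution_inl ?_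
        rintro _ h
        simp_all
      · exact hx.commute_cliffordInvolution_inl (by simp)
    have hvanish : p * (x (.inl (j, false)) * b) * p = 0 := by
      have h : ε (.inl j) • (p * (x (.inl (j, false)) * b) * p) =
          -(ε (.inl j) • (p * (x (.inl (j, false)) * b) * p)) := by
        conv_lhs => rw [← smul_mul_assoc, ← smul_mul_assoc, ← hp', mul_assoc p,
          ← mul_assoc _ (x (.inl (j, false))), hx.cliffordInvolution_inl_mul, neg_mul,
          mul_assoc (x _), hb'.eq, mul_neg, neg_mul, mul_assoc p, ← mul_assoc (x _),
          mul_assoc _ _ p, hp, mul_smul_comm, mul_smul_comm]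
        rw [mul_assoc p]
      have h2 : (2 : ℂ) • (ε (.inl j) • (p * (x (.inl (j, false)) * b) * p)) = 0 := by
        rw [two_smul]
        nth_rewrite 1 [h]
        exact neg_add_cancel _
      simpa [smul_smul, hε] using h2
    obtain ⟨c, hc⟩ := ih ha
    exact ⟨c, by rwa [mul_add, add_mul, hvanish, add_zero]⟩

theorem primitive [Fintype μ] {p : A} {ε : μ ⊕ τ → ℂ} (hpp : p * p = p)
    (hε : ∀ j, ε j ≠ 0) (hp : ∀ j, cliffordInvolution x j * p = ε j • p)
    (hp' : ∀ j, p * cliffordInvolution x j = ε j • p) (q : A) (hq : q * q = q)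
    (hpq : p * q = q) (hqp : q * p = q) : q = 0 ∨ q = p := by
  obtain ⟨s, hs, hqs⟩ := hx.exists_mul_eq_mul hp q
  rw [← Finset.coe_univ] at hs
  obtain ⟨c, hc⟩ := hx.exists_sub_smul_mem_jacobson hpp hε hp hp' Finset.univ hs
  rw [mul_assoc, ← hqs, hqp, hpq] at hc
  exact eq_zero_or_eq_of_sub_smul_mem_jacobson hpp hq hpq hqp hc

theorem finrank_range_mulRight_le [FiniteDimensional ℂ A] {p : A} {ε : μ ⊕ τ → ℂ}
    (hp : ∀ j, cliffordInvolution x j * p = ε j • p) :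
    Module.finrank ℂ (LinearMap.range (LinearMap.mulRight ℂ p)) ≤
      Module.finrank ℂ (Algebra.adjoin ℂ (polarizingSet x Set.univ)) := by
  refine (Submodule.finrank_mono (t := (Subalgebra.toSubmodule
    (Algebra.adjoin ℂ (polarizingSet x Set.univ))).map (LinearMap.mulRight ℂ p)) ?_).trans
    (Submodule.finrank_map_le _ _)
  rintro _ ⟨a, rfl⟩
  obtain ⟨s, hs, h⟩ := hx.exists_mul_eq_mul hp a
  exact ⟨s, hs, h.symm⟩

end IsCliffordSystem

theorem finrank_le_sum_finrank_range_mulRight {ι : Type*} [Fintype ι] [FiniteDimensional ℂ A]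
    (p : ι → A) (hsum : ∑ i, p i = 1) :
    Module.finrank ℂ A ≤ ∑ i, Module.finrank ℂ (LinearMap.range (LinearMap.mulRight ℂ (p i))) := by
  classical
  rw [← Module.finrank_pi_fintype]
  refine LinearMap.finrank_le_finrank_of_surjective (f := LinearMap.lsum ℂ _ ℂ
    fun i => (LinearMap.range (LinearMap.mulRight ℂ (p i))).subtype) fun a => ?_
  refine ⟨fun i => ⟨a * p i, a, rfl⟩, ?_⟩
  simp [LinearMap.lsum_apply, ← Finset.mul_sum, hsum]

end CliffordSystem

section CliffordAlgebra

variable {V : Type*} [AddCommGroup V] [Module ℂ V] [FiniteDimensional ℂ V]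

namespace CliffordAlgebra

variable (Q : QuadraticForm ℂ V)

/-- The basis of the Clifford algebra corresponding to the standard basis of the exterior
algebra. -/
noncomputable def basisOfExterior :
    Module.Basis (Finset (Fin (Module.finrank ℂ V))) ℂ (CliffordAlgebra Q) :=
  have : Invertible (2 : ℂ) := invertibleOfNonzero two_ne_zero
  (Module.finBasis ℂ V).ExteriorAlgebra.map (equivExterior Q).symm

instance finiteDimensional_complex : FiniteDimensional ℂ (CliffordAlgebra Q) :=
  .of_basis (basisOfExterior Q)

theorem finrank_complex :
    Module.finrank ℂ (CliffordAlgebra Q) = 2 ^ Module.finrank ℂ V := by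
  simp [Module.finrank_eq_card_basis (basisOfExterior Q)]

theorem finrank_adjoin_le {σ : Type*} [Fintype σ] (u : σ → V) :
    Module.finrank ℂ (Algebra.adjoin ℂ (Set.range fun i => ι Q (u i))) ≤ 2 ^ Fintype.card σ := by
  let W := Submodule.span ℂ (Set.range u)
  let f : CliffordAlgebra (Q.comp W.subtype) →ₐ[ℂ] CliffordAlgebra Q :=
    lift _ ⟨ι Q ∘ₗ W.subtype, fun m => ι_sq_scalar Q m⟩
  have hle : Algebra.adjoin ℂ (Set.range fun i => ι Q (u i)) ≤ f.range := by
    rw [Algebra.adjoin_le_iff]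
    rintro _ ⟨i, rfl⟩
    exact ⟨ι _ ⟨u i, Submodule.subset_span ⟨i, rfl⟩⟩, lift_ι_apply _ _ _⟩
  calc Module.finrank ℂ (Algebra.adjoin ℂ (Set.range fun i => ι Q (u i)))
      ≤ Module.finrank ℂ f.range := Submodule.finrank_mono (R := ℂ)
        (s := Subalgebra.toSubmodule (Algebra.adjoin ℂ (Set.range fun i => ι Q (u i))))
        (t := Subalgebra.toSubmodule f.range) hle
    _ ≤ Module.finrank ℂ (CliffordAlgebra (Q.comp W.subtype)) :=
      LinearMap.finrank_range_le f.toLinearMap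
    _ = 2 ^ Module.finrank ℂ W := finrank_complex _
    _ ≤ 2 ^ Fintype.card σ := Nat.pow_le_pow_right two_pos (finrank_range_le_card u)

omit [FiniteDimensional ℂ V] in
theorem isCliffordSystem {μ τ δ : Type*} (v : Module.Basis ((μ × Bool) ⊕ τ ⊕ δ) ℂ V)
    (hortho : ∀ i j, i ≠ j → Q.IsOrtho (v i) (v j)) (hpair : ∀ j, Q (v (.inl j)) = 1)
    (hsingle : ∀ t, Q (v (.inr (.inl t))) = 1) (hradical : ∀ k, Q (v (.inr (.inr k))) = 0) :
    IsCliffordSystem fun i => ι Q (v i) where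
  anticomm i j hij := ι_mul_ι_comm_of_isOrtho (hortho i j hij)
  sq_pair j := by rw [ι_sq_scalar, hpair, map_one]
  sq_single t := by rw [ι_sq_scalar, hsingle, map_one]
  sq_radical k := by rw [ι_sq_scalar, hradical, map_zero]
  adjoin_range := by
    rw [eq_top_iff, ← adjoin_range_ι, Algebra.adjoin_le_iff]
    rintro _ ⟨m, rfl⟩
    have h : Submodule.span ℂ (Set.range v) ≤ (Subalgebra.toSubmodule
        (Algebra.adjoin ℂ (Set.range fun i => ι Q (v i)))).comap (ι Q) :=
      Submodule.span_le.mpr (by rintro _ ⟨i, rfl⟩; exact Algebra.subset_adjoin ⟨i, rfl⟩)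
    exact h (v.mem_span m)

end CliffordAlgebra

theorem exists_orthogonal_basis (Q : QuadraticForm ℂ V) (n : ℕ)
    (hn : n = Module.finrank ℂ V -
      Module.finrank ℂ (LinearMap.ker (QuadraticMap.polarBilin Q))) :
    ∃ v : Module.Basis ((Fin (n / 2) × Bool) ⊕ Fin (n % 2) ⊕ Fin (Module.finrank ℂ V - n)) ℂ V,
      (∀ i j, i ≠ j → Q.IsOrtho (v i) (v j)) ∧ (∀ j, Q (v (.inl j)) = 1) ∧
      (∀ t, Q (v (.inr (.inl t))) = 1) ∧ ∀ k, Q (v (.inr (.inr k))) = 0 := by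
  classical
  have : Invertible (2 : ℂ) := invertibleOfNonzero two_ne_zero
  obtain ⟨w₀, ⟨e₀⟩⟩ := Q.equivalent_weightedSumSquares
  let w : Fin (Module.finrank ℂ V) → ℂ := fun i => if w₀ i = 0 then 0 else 1
  have e : Q.IsometryEquiv (QuadraticMap.weightedSumSquares ℂ w) :=
    e₀.trans (QuadraticForm.isometryEquivSumSquares w₀)
  have hker := QuadraticForm.finrank_radical_of_equiv_weightedSumSquares ⟨e⟩
  rw [QuadraticMap.radical_eq_ker_polarBilin] at hker
  have hle := Submodule.finrank_le (LinearMap.ker (QuadraticMap.polarBilin Q))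
  have hcard0 : Fintype.card {i // w i = 0} = Module.finrank ℂ V - n := by
    rw [← Nat.card_eq_fintype_card]
    have : Nat.card {i // w i = 0} = {i | w i = 0}.ncard := rfl
    omega
  have hcard1 : Fintype.card {i // ¬ w i = 0} = n / 2 * 2 + n % 2 := by
    rw [Fintype.card_subtype_compl, hcard0, Fintype.card_fin]
    omega
  let e0 : {i // w i = 0} ≃ Fin (Module.finrank ℂ V - n) := Fintype.equivFinOfCardEq hcard0
  let e1 : {i // ¬ w i = 0} ≃ (Fin (n / 2) × Bool) ⊕ Fin (n % 2) :=
    Fintype.equivOfCardEq (by simpa using hcard1)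
  let E : Fin (Module.finrank ℂ V) ≃ (Fin (n / 2) × Bool) ⊕ Fin (n % 2) ⊕
      Fin (Module.finrank ℂ V - n) :=
    (Equiv.sumCompl fun i => w i = 0).symm.trans <| (Equiv.sumComm _ _).trans <|
      (Equiv.sumCongr e1 e0).trans (Equiv.sumAssoc _ _ _)
  let b : Module.Basis (Fin (Module.finrank ℂ V)) ℂ V :=
    (Pi.basisFun ℂ (Fin (Module.finrank ℂ V))).map e.toLinearEquiv.symm
  have heb (i) : e (b i) = Pi.single i 1 := by
    simp [b]
  have hQb (i) : Q (b i) = w i := by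
    rw [← e.map_app, heb]
    simp [QuadraticMap.weightedSumSquares_apply, Pi.single_apply]
  have hw1 (i) (hi : w i ≠ 0) : w i = 1 := by
    simp only [w] at hi ⊢
    split_ifs at hi ⊢ <;> simp_all
  refine ⟨b.reindex E, fun i j hij => ?_, fun j => ?_, fun t => ?_, fun k => ?_⟩
  · rw [QuadraticMap.isOrtho_def, Module.Basis.reindex_apply, Module.Basis.reindex_apply, hQb, hQb,
      ← e.map_app, map_add, heb, heb]
    have hij' : E.symm i ≠ E.symm j := E.symm.injective.ne hij
    simp [QuadraticMap.weightedSumSquares_apply, Pi.single_apply, mul_add,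
      Finset.sum_add_distrib, hij', hij'.symm]
  · rw [Module.Basis.reindex_apply, hQb]
    exact hw1 _ (e1.symm (.inl j)).2
  · rw [Module.Basis.reindex_apply, hQb]
    exact hw1 _ (e1.symm (.inr t)).2
  · rw [Module.Basis.reindex_apply, hQb]
    exact (e0.symm k).2

end CliffordAlgebra

/-- Every nonzero finite-dimensional indecomposable projective module over
the Clifford algebra of a quadratic form `Q` of rank `n` on an
`N`-dimensional complex vector space has complex dimension `2^(N - ⌈n/2⌉)`.
(`⌈n/2⌉ = (n+1)/2` in natural number arithmetic; indecomposability is stated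
as: `M` is nonzero and is not the internal direct sum of two nonzero
submodules.) -/
theorem stmt8 {V : Type*} [AddCommGroup V] [Module ℂ V] [FiniteDimensional ℂ V]
    (Q : QuadraticForm ℂ V) (N n : ℕ)
    (hN : N = Module.finrank ℂ V)
    (hn : n = Module.finrank ℂ V -
      Module.finrank ℂ (LinearMap.ker (QuadraticMap.polarBilin Q)))
    (M : Type*) [AddCommGroup M] [Module ℂ M] [Module (CliffordAlgebra Q) M]
    [IsScalarTower ℂ (CliffordAlgebra Q) M] [FiniteDimensional ℂ M]
    (hproj : Module.Projective (CliffordAlgebra Q) M)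
    (hnz : Nontrivial M)
    (hindec : ¬ ∃ (N₁ N₂ : Submodule (CliffordAlgebra Q) M),
      N₁ ≠ ⊥ ∧ N₂ ≠ ⊥ ∧ IsCompl N₁ N₂) :
    Module.finrank ℂ M = 2 ^ (N - (n + 1) / 2) := by
  subst hN
  obtain ⟨v, hortho, hpair, hsingle, hradical⟩ := exists_orthogonal_basis Q n hn
  have hx := CliffordAlgebra.isCliffordSystem Q v hortho hpair hsingle hradical
  have : Subsingleton (Fin (n % 2)) := Fin.subsingleton_iff_le_one.mpr (by omega)
  obtain ⟨p, hsum, hpp, hhp, hph⟩ := exists_idempotents_of_involutions _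
    hx.cliffordInvolution_comm hx.cliffordInvolution_sq
  have hle : ∀ s ∈ Finset.univ, Module.finrank ℂ (LinearMap.range (LinearMap.mulRight ℂ (p s))) ≤
      2 ^ (Module.finrank ℂ V - (n + 1) / 2) := by
    intro s _
    refine (hx.finrank_range_mulRight_le (hhp s)).trans ?_
    have h := CliffordAlgebra.finrank_adjoin_le Q
      (Sum.elim (fun j => v (.inl (j, false))) (fun k => v (.inr (.inr k))))
    have hset : polarizingSet (fun i => CliffordAlgebra.ι Q (v i)) Set.univ =
        Set.range fun i => CliffordAlgebra.ι Q
          (Sum.elim (fun j => v (.inl (j, false))) (fun k => v (.inr (.inr k))) i) := by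
      rw [polarizingSet, Set.image_univ, ← Set.Sum.elim_range]
      congr 1
      ext (j | k) <;> rfl
    rw [hset]
    refine h.trans_eq ?_
    rw [Fintype.card_sum, Fintype.card_fin, Fintype.card_fin]
    congr 1
    omega
  have heq : ∀ s ∈ Finset.univ, Module.finrank ℂ (LinearMap.range (LinearMap.mulRight ℂ (p s))) =
      2 ^ (Module.finrank ℂ V - (n + 1) / 2) := by
    refine (Finset.sum_eq_sum_iff_of_le hle).mp (le_antisymm (Finset.sum_le_sum hle) ?_)
    refine le_trans (le_of_eq ?_) (finrank_le_sum_finrank_range_mulRight p hsum)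
    rw [CliffordAlgebra.finrank_complex]
    simp only [Finset.sum_const, Finset.card_univ, Fintype.card_pi, Finset.prod_const,
      Fintype.card_units_int, Fintype.card_sum, Fintype.card_fin, smul_eq_mul, ← pow_add]
    congr 1
    omega
  obtain ⟨s, hs⟩ := exists_finrank_eq_finrank_range_mulRight hindec p hpp hsum fun s =>
    hx.primitive (hpp s) (fun j => by simp) (hhp s) (hph s)
  rw [hs, heq s (Finset.mem_univ s)]
end

section
/- Let V be a complex vector space of dimension d and let Q be any quadratic form on V. If M is a finite-dimensional projective module over the Clifford algebra Cl(Q), then 2^{⌊d/2⌋} divides dim_ℂ M. -/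
/-- If endomorphisms `e i` anticommute and square to zero, and admit `j k` with
`e i * j k + j k * e i = δ i k`, then `2 ^ n` divides the dimension of the space they act on. -/
theorem two_pow_dvd_finrank_of_anticomm {K : Type*} [Field K] (n : ℕ) :
    ∀ (N : Type*) [AddCommGroup N] [Module K N] [FiniteDimensional K N]
      (e j : Fin n → Module.End K N),
      (∀ i x, e i (e i x) = 0) →
      (∀ i k x, e i (e k x) + e k (e i x) = 0) →
      (∀ i k x, e i (j k x) + j k (e i x) = if i = k then x else 0) →
      2 ^ n ∣ Module.finrank K N := by
  induction n with
  | zero => simp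
  | succ n ih =>
    intro N _ _ _ e j hsq hanti hej
    have hker : LinearMap.range (e 0) = LinearMap.ker (e 0) := by
      ext x
      simp only [LinearMap.mem_range, LinearMap.mem_ker]
      constructor
      · rintro ⟨y, rfl⟩
        exact hsq 0 y
      · intro hx
        have := hej 0 0 x
        rw [hx] at this
        exact ⟨j 0 x, by simpa using this⟩
    have hdim := LinearMap.finrank_range_add_finrank_ker (e 0)
    rw [hker] at hdim
    have he : ∀ i : Fin n, ∀ x ∈ LinearMap.ker (e 0), e i.succ x ∈ LinearMap.ker (e 0) := by
      intro i x hx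
      have := hanti 0 i.succ x
      rw [LinearMap.mem_ker] at hx ⊢
      simpa [hx] using this
    have hj : ∀ i : Fin n, ∀ x ∈ LinearMap.ker (e 0), j i.succ x ∈ LinearMap.ker (e 0) := by
      intro i x hx
      have := hej 0 i.succ x
      rw [LinearMap.mem_ker] at hx ⊢
      simpa [hx, (Fin.succ_ne_zero i).symm] using this
    obtain ⟨c, hc⟩ := ih (LinearMap.ker (e 0)) (fun i => (e i.succ).restrict (he i))
      (fun i => (j i.succ).restrict (hj i))
      (fun i x => Subtype.ext (by simpa using hsq i.succ x))
      (fun i k x => Subtype.ext (by simpa using hanti i.succ k.succ x))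
      (fun i k x => Subtype.ext (by
        have := hej i.succ k.succ x
        simp only [Fin.succ_inj] at this
        split_ifs at this ⊢ <;> simpa using this))
    exact ⟨c, by rw [← hdim, hc]; ring⟩

/-- A diagonal binary quadratic form over an algebraically closed field has a nonzero zero. -/
theorem exists_isotropic_pair {K : Type*} [Field K] [IsAlgClosed K] (a b : K) :
    ∃ x y : K, a * (x * x) + b * (y * y) = 0 ∧ (x = 1 ∨ y = 1) := by
  by_cases ha : a = 0
  · exact ⟨1, 0, by simp [ha], Or.inl rfl⟩
  · obtain ⟨z, hz⟩ := IsAlgClosed.exists_pow_nat_eq (-b / a) (n := 2) (by norm_num)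
    refine ⟨z, 1, ?_, Or.inr rfl⟩
    rw [← pow_two, hz]
    field_simp
    ring

open QuadraticMap in
/-- A quadratic form on a space of dimension `d` over an algebraically closed field of
characteristic not two has a totally isotropic subspace of dimension `d / 2`, given here by a
family of vectors together with a dual family of functionals. -/
theorem QuadraticForm.exists_isotropic_family {K V : Type*} [Field K] [IsAlgClosed K]
    [Invertible (2 : K)] [AddCommGroup V] [Module K V] [FiniteDimensional K V]
    (Q : QuadraticForm K V) :
    ∃ (e : Fin (Module.finrank K V / 2) → V)
      (f : Fin (Module.finrank K V / 2) → Module.Dual K V),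
      (∀ i, Q (e i) = 0) ∧ (∀ i k, i ≠ k → polar Q (e i) (e k) = 0) ∧
      ∀ i k, f k (e i) = if i = k then 1 else 0 := by
  obtain ⟨w, ⟨g⟩⟩ := QuadraticForm.equivalent_weightedSumSquares Q
  generalize Module.finrank K V = d at w g ⊢
  let l : Fin (d / 2) → Fin d := fun i => ⟨2 * i, by omega⟩
  let r : Fin (d / 2) → Fin d := fun i => ⟨2 * i + 1, by omega⟩
  have hll : ∀ i k, l i = l k ↔ i = k := fun i k => by simp only [l, Fin.ext_iff]; omega
  have hrr : ∀ i k, r i = r k ↔ i = k := fun i k => by simp only [r, Fin.ext_iff]; omega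
  have hlr : ∀ i k, l i ≠ r k := fun i k => by simp only [l, r, ne_eq, Fin.ext_iff]; omega
  choose x y hxy h1 using fun i => exists_isotropic_pair (w (l i)) (w (r i))
  let u : Fin (d / 2) → Fin d → K := fun i => Pi.single (l i) (x i) + Pi.single (r i) (y i)
  have hul : ∀ i k, u i (l k) = if i = k then x i else 0 := fun i k => by
    by_cases h : i = k
    · subst h; simp [u, hlr]
    · have h' : l k ≠ l i := fun h' => h ((hll _ _).1 h').symm
      simp [u, hlr, h, h']
  have hur : ∀ i k, u i (r k) = if i = k then y i else 0 := fun i k => by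
    by_cases h : i = k
    · subst h; simp [u, (hlr _ _).symm]
    · have h' : r k ≠ r i := fun h' => h ((hrr _ _).1 h').symm
      simp [u, (hlr _ _).symm, h, h']
  have hu0 : ∀ i t, t ≠ l i → t ≠ r i → u i t = 0 := fun i t h h' => by simp [u, h, h']
  have hdisj : ∀ i k, i ≠ k → ∀ t, u i t * u k t = 0 := fun i k hik t => by
    by_cases h : t = l i
    · subst h; simp [hul, hik.symm]
    · by_cases h' : t = r i
      · subst h'; simp [hur, hik.symm]
      · simp [hu0 i t h h']
  have hpull : ∀ z, Q (g.symm z) = weightedSumSquares K w z := fun z => g.symm.map_app z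
  have hpick : ∀ k, ∃ t, ∀ i, u i t = if i = k then 1 else 0 := fun k => by
    rcases h1 k with h | h
    · refine ⟨l k, fun i => ?_⟩
      rw [hul]; split_ifs with hik
      · rw [hik, h]
      · rfl
    · refine ⟨r k, fun i => ?_⟩
      rw [hur]; split_ifs with hik
      · rw [hik, h]
      · rfl
  choose t ht using hpick
  refine ⟨fun i => g.symm (u i),
    fun k => LinearMap.proj (t k) ∘ₗ (g.toLinearEquiv : V →ₗ[K] (Fin d → K)), ?_, ?_, ?_⟩
  · intro i
    rw [hpull, weightedSumSquares_apply, Finset.sum_eq_add (l i) (r i) (hlr i i)]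
    · simpa [hul, hur] using hxy i
    · rintro c - ⟨hc, hc'⟩
      simp [hu0 i c hc hc']
    · simp
    · simp
  · intro i k hik
    have hadd : g.symm (u i) + g.symm (u k) = g.symm (u i + u k) :=
      (map_add g.symm.toLinearEquiv _ _).symm
    simp only [polar, hadd, hpull, weightedSumSquares_apply]
    rw [← Finset.sum_sub_distrib, ← Finset.sum_sub_distrib]
    refine Finset.sum_eq_zero fun c _ => ?_
    simp only [Pi.add_apply, smul_eq_mul]
    linear_combination 2 * w c * hdisj i k hik c
  · intro i k
    simp [ht]

open CliffordAlgebra in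
/-- A functional on `V` acts on a projective module over `CliffordAlgebra Q` by an operator
satisfying the commutation relation of the contraction with left multiplication by vectors. -/
theorem CliffordAlgebra.exists_contraction_of_projective {K V M : Type*} [Field K]
    [AddCommGroup V] [Module K V] (Q : QuadraticForm K V) [AddCommGroup M] [Module K M]
    [Module (CliffordAlgebra Q) M] [IsScalarTower K (CliffordAlgebra Q) M]
    [Module.Projective (CliffordAlgebra Q) M] (f : Module.Dual K V) :
    ∃ j : Module.End K M, ∀ v x, ι Q v • j x + j (ι Q v • x) = f v • x := by
  obtain ⟨s, hs⟩ := Module.projective_def'.1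
    (inferInstance : Module.Projective (CliffordAlgebra Q) M)
  let p : (M →₀ CliffordAlgebra Q) →ₗ[CliffordAlgebra Q] M :=
    Finsupp.linearCombination (CliffordAlgebra Q) id
  have hps : ∀ x, p (s x) = x := fun x => LinearMap.congr_fun hs x
  let c : Module.End K (M →₀ CliffordAlgebra Q) :=
    Finsupp.mapRange.linearMap (contractLeft f)
  have hc : ∀ v z, ι Q v • c z + c (ι Q v • z) = f v • z := fun v z => by
    ext m
    simp [c, contractLeft_ι_mul]
  refine ⟨p.restrictScalars K ∘ₗ c ∘ₗ s.restrictScalars K, fun v x => ?_⟩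
  have := congrArg (p.restrictScalars K) (hc v (s x))
  rw [map_add, map_smul (p.restrictScalars K) (f v)] at this
  simpa [hps] using this

open CliffordAlgebra in

/-- If `M` is a finite-dimensional projective module over the Clifford
algebra of any quadratic form `Q` on a `d`-dimensional complex vector space,
then `2^⌊d/2⌋` divides `dim_ℂ M`. -/
theorem stmt10 {V : Type*} [AddCommGroup V] [Module ℂ V] [FiniteDimensional ℂ V]
    (Q : QuadraticForm ℂ V) (d : ℕ) (hd : d = Module.finrank ℂ V)
    (M : Type*) [AddCommGroup M] [Module ℂ M] [Module (CliffordAlgebra Q) M]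
    [IsScalarTower ℂ (CliffordAlgebra Q) M] [FiniteDimensional ℂ M]
    (hproj : Module.Projective (CliffordAlgebra Q) M) :
    2 ^ (d / 2) ∣ Module.finrank ℂ M := by
  obtain ⟨e, f, hQ, hpolar, hf⟩ := QuadraticForm.exists_isotropic_family Q
  choose j hj using fun k =>
    CliffordAlgebra.exists_contraction_of_projective (M := M) Q (f k)
  subst hd
  refine two_pow_dvd_finrank_of_anticomm _ M
    (fun i => Algebra.lsmul ℂ ℂ M (CliffordAlgebra.ι Q (e i))) j ?_ ?_ ?_
  · intro i x
    simp [smul_smul, hQ]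
  · intro i k x
    by_cases hik : i = k
    · subst hik
      simp [smul_smul, hQ]
    · simp [smul_smul, ← add_smul, CliffordAlgebra.ι_mul_ι_add_swap, hpolar i k hik]
  · intro i k x
    have := hj k (e i) x
    rw [hf] at this
    simpa using this
end
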